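/- (Data consistency.) Let X, X₊ be real n×t matrices, U a real m×t matrix, B a real n×m matrix, L > 0 and α ≥ 0. Then there exist a real n×n matrix A with Aᵀ·A ⪯ L²·Iₙ and a real n×t matrix V with Vᵀ·V ⪯ α²·t·I_t such that X₊ − B·U = A·X + V, if and only if there exists a real n×t matrix Γ̂ such that the symmetric block matrix [[L²·Iₙ, Γ̂],[Γ̂ᵀ, α²·t·I_t]] is positive semidefinite and L²·Xᵀ·X + Xᵀ·Γ̂ + Γ̂ᵀ·X + t·α²·I_t − (X₊ − B·U)ᵀ·(X₊ − B·U) is positive semidefinite. -/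

import Mathlib

open Matrix

theorem LinearMap.exists_contraction_comp_eq {𝕜 E F G : Type*} [RCLike 𝕜]
    [AddCommGroup E] [Module 𝕜 E]
    [NormedAddCommGroup F] [InnerProductSpace 𝕜 F] [FiniteDimensional 𝕜 F]
    [NormedAddCommGroup G] [InnerProductSpace 𝕜 G]
    (y : E →ₗ[𝕜] G) (z : E →ₗ[𝕜] F) (h : ∀ w, ‖y w‖ ≤ ‖z w‖) :
    ∃ c : F →ₗ[𝕜] G, c ∘ₗ z = y ∧ ∀ v, ‖c v‖ ≤ ‖v‖ := by
  obtain ⟨s, hs⟩ := z.rangeRestrict.exists_rightInverse_of_surjective z.range_rangeRestrict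
  have hzs (u : z.range) : z (s u) = u := congrArg Subtype.val (LinearMap.congr_fun hs u)
  refine ⟨y ∘ₗ s ∘ₗ z.range.orthogonalProjectionOnto.toLinearMap, ?_, fun v => ?_⟩
  · ext w
    have hP : z.range.orthogonalProjectionOnto (z w) = z.rangeRestrict w :=
      z.range.orthogonalProjectionOnto_mem_subspace_eq_self (z.rangeRestrict w)
    rw [← sub_eq_zero, ← norm_le_zero_iff]
    simp only [LinearMap.comp_apply, ContinuousLinearMap.coe_coe, hP, ← map_sub]
    refine (h _).trans_eq ?_
    simp [hzs]
  · refine (h _).trans ?_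
    simp only [LinearMap.comp_apply, ContinuousLinearMap.coe_coe, hzs]
    exact z.range.norm_orthogonalProjectionOnto_apply_le v

theorem Matrix.norm_toLpLin_sq {r k : Type*} [Fintype r] [Fintype k] [DecidableEq k]
    (W : Matrix r k ℝ) (w : EuclideanSpace ℝ k) :
    ‖toLpLin 2 2 W w‖ ^ 2 = w.ofLp ⬝ᵥ (Wᵀ * W) *ᵥ w.ofLp := by
  rw [← real_inner_self_eq_norm_sq, EuclideanSpace.inner_eq_star_dotProduct, ← mulVec_mulVec,
    dotProduct_mulVec, vecMul_transpose]
  simp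

theorem Matrix.posSemidef_sub_transpose_mul_self_iff {p q k : Type*} [Fintype p] [Fintype q]
    [Fintype k] [DecidableEq k] (Y : Matrix p k ℝ) (Z : Matrix q k ℝ) :
    (Zᵀ * Z - Yᵀ * Y).PosSemidef ↔
      ∀ w, ‖toLpLin 2 2 Y w‖ ≤ ‖toLpLin 2 2 Z w‖ := by
  have herm : (Zᵀ * Z - Yᵀ * Y).IsHermitian := by
    simp [IsHermitian, conjTranspose_eq_transpose_of_trivial]
  rw [posSemidef_iff_dotProduct_mulVec, and_iff_right herm]
  refine ⟨fun h w => ?_, fun h w => ?_⟩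
  · have := h w.ofLp
    rw [star_trivial, sub_mulVec, dotProduct_sub, ← norm_toLpLin_sq, ← norm_toLpLin_sq,
      sub_nonneg] at this
    exact (sq_le_sq₀ (norm_nonneg _) (norm_nonneg _)).1 this
  · have := pow_le_pow_left₀ (norm_nonneg _) (h (WithLp.toLp 2 w)) 2
    rw [norm_toLpLin_sq, norm_toLpLin_sq] at this
    simpa [sub_mulVec, dotProduct_sub] using this

theorem Matrix.exists_contraction_mul_eq {p q k : Type*} [Fintype p] [Fintype q] [Fintype k]
    [DecidableEq q] {Y : Matrix p k ℝ} {Z : Matrix q k ℝ}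
    (h : (Zᵀ * Z - Yᵀ * Y).PosSemidef) :
    ∃ C : Matrix p q ℝ, (1 - Cᵀ * C).PosSemidef ∧ C * Z = Y := by
  classical
  obtain ⟨c, hc, hle⟩ := LinearMap.exists_contraction_comp_eq _ _
    ((posSemidef_sub_transpose_mul_self_iff Y Z).1 h)
  refine ⟨(toLpLin 2 2).symm c, ?_, (toLpLin 2 2).injective ?_⟩
  · have := (posSemidef_sub_transpose_mul_self_iff ((toLpLin 2 2).symm c) (1 : Matrix q q ℝ)).2
    simp only [LinearEquiv.apply_symm_apply, toLpLin_one, transpose_one, mul_one] at this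
    exact this hle
  · rw [toLpLin_mul 2 2 2, LinearEquiv.apply_symm_apply, hc]

theorem Matrix.PosSemidef.fromBlocks_diagonal {p q : Type*} [Fintype p] [Fintype q]
    [DecidableEq p] [DecidableEq q] {P : Matrix p p ℝ} {Q : Matrix q q ℝ}
    (hP : P.PosSemidef) (hQ : Q.PosSemidef) : (fromBlocks P 0 0 Q).PosSemidef := by
  have h := (hP.conjTranspose_mul_mul_same (fromCols 1 (0 : Matrix p q ℝ))).add
    (hQ.conjTranspose_mul_mul_same (fromCols (0 : Matrix q p ℝ) 1))
  simp only [conjTranspose_fromCols_eq_fromRows_conjTranspose, fromRows_mul, mul_fromCols,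
    fromCols_fromRows_eq_fromBlocks] at h
  simpa [fromBlocks_add] using h

open scoped MatrixOrder Matrix.Norms.L2Operator in
theorem Matrix.PosSemidef.exists_transpose_mul_self {k : Type*} [Fintype k] [DecidableEq k]
    {M : Matrix k k ℝ} (hM : M.PosSemidef) : ∃ N : Matrix k k ℝ, M = Nᵀ * N := by
  obtain ⟨N, hN⟩ := CStarAlgebra.nonneg_iff_eq_star_mul_self.1 hM.nonneg
  exact ⟨N, by rw [hN, star_eq_conjTranspose, conjTranspose_eq_transpose_of_trivial]⟩

/-- Corollary 1, data consistency: there exist `A ∈ 𝓛_L` and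
`V ∈ 𝓛_{α√t}` with `X₊ - B U = A X + V` iff there exists `Γ̂` making the two LMIs
\eqref{eq:ver1}–\eqref{eq:ver2} feasible. -/
theorem stmt_9 {n t md : ℕ} (X Xp : Matrix (Fin n) (Fin t) ℝ)
    (U : Matrix (Fin md) (Fin t) ℝ) (B : Matrix (Fin n) (Fin md) ℝ)
    (L α : ℝ) (hL : 0 < L) (hα : 0 ≤ α) :
    (∃ (A : Matrix (Fin n) (Fin n) ℝ) (V : Matrix (Fin n) (Fin t) ℝ),
        (L ^ 2 • (1 : Matrix (Fin n) (Fin n) ℝ) - Aᵀ * A).PosSemidef ∧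
        ((α ^ 2 * (t : ℝ)) • (1 : Matrix (Fin t) (Fin t) ℝ) - Vᵀ * V).PosSemidef ∧
        Xp - B * U = A * X + V) ↔
      ∃ Γhat : Matrix (Fin n) (Fin t) ℝ,
        (Matrix.fromBlocks (L ^ 2 • (1 : Matrix (Fin n) (Fin n) ℝ)) Γhat Γhatᵀ
            ((α ^ 2 * (t : ℝ)) • (1 : Matrix (Fin t) (Fin t) ℝ))).PosSemidef ∧
        (L ^ 2 • (Xᵀ * X) + Xᵀ * Γhat + Γhatᵀ * X +
            ((t : ℝ) * α ^ 2) • (1 : Matrix (Fin t) (Fin t) ℝ) -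
            (Xp - B * U)ᵀ * (Xp - B * U)).PosSemidef := by
  constructor
  · rintro ⟨A, V, hA, hV, hY⟩
    refine ⟨Aᵀ * V, ?_, ?_⟩
    · have h := (hA.fromBlocks_diagonal hV).add
        (posSemidef_conjTranspose_mul_self (fromCols A V))
      rw [conjTranspose_fromCols_eq_fromRows_conjTranspose, fromRows_mul_fromCols] at h
      simpa [conjTranspose_eq_transpose_of_trivial, fromBlocks_add, transpose_mul] using h
    · rw [hY]
      convert (hA.conjTranspose_mul_mul_same X).add hV using 1
      simp only [conjTranspose_eq_transpose_of_trivial, transpose_add, transpose_mul,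
        transpose_transpose, Matrix.mul_add, Matrix.add_mul, Matrix.mul_sub, Matrix.sub_mul,
        Matrix.mul_smul, Matrix.smul_mul, Matrix.mul_one, Matrix.mul_assoc, mul_comm (t : ℝ)]
      abel
  · rintro ⟨Γ, hM, hY⟩
    obtain ⟨N, hN⟩ := hM.exists_transpose_mul_self
    rw [← fromCols_toCols N, transpose_fromCols, fromRows_mul_fromCols, fromBlocks_inj] at hN
    obtain ⟨h₁₁, h₁₂, h₂₁, h₂₂⟩ := hN
    set N₁ := N.toCols₁
    set N₂ := N.toCols₂
    have hZ : ((N₁ * X + N₂)ᵀ * (N₁ * X + N₂) - (Xp - B * U)ᵀ * (Xp - B * U)).PosSemidef := by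
      convert hY using 2
      have h : Xᵀ * (N₁ᵀ * (N₁ * X)) = L ^ 2 • (Xᵀ * X) := by
        rw [← Matrix.mul_assoc N₁ᵀ, ← h₁₁, Matrix.smul_mul, Matrix.one_mul, Matrix.mul_smul]
      rw [h₂₁, h₁₂, mul_comm (t : ℝ), h₂₂, ← h]
      simp only [transpose_add, transpose_mul, Matrix.mul_add, Matrix.add_mul, Matrix.mul_assoc]
      abel
    obtain ⟨C, hC, hCY⟩ := exists_contraction_mul_eq hZ
    refine ⟨C * N₁, C * N₂, ?_, ?_, ?_⟩
    · rw [h₁₁]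
      simpa [conjTranspose_eq_transpose_of_trivial, Matrix.mul_sub, Matrix.sub_mul,
        Matrix.mul_assoc] using hC.conjTranspose_mul_mul_same N₁
    · rw [h₂₂]
      simpa [conjTranspose_eq_transpose_of_trivial, Matrix.mul_sub, Matrix.sub_mul,
        Matrix.mul_assoc] using hC.conjTranspose_mul_mul_same N₂
    · rw [← hCY, Matrix.mul_add, Matrix.mul_assoc]
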